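/- Fix ρ ∈ (0,1), t > 0, an integer n ≥ 1 and a strictly decreasing map X₀ : {1,…,n} → ℤ, and for each 0 ≤ k ≤ n−1 let h_k solve the backwards-heat IBVP for (ρ,n,k,X₀), with Ψ^n_{ρ,k} and Φ^n_{ρ,k} defined as below. For any 0 ≤ m ≤ n define K^l(x,y) := Σ_{k=0}^{m−1} Ψ^n_{ρ,k}(x)Φ^n_{ρ,k}(y) and K^r(x,y) := Σ_{k=m}^{n−1} Ψ^n_{ρ,k}(x)Φ^n_{ρ,k}(y). Then for all x, y ∈ ℤ, the sum Σ_{z∈ℤ} K^r(x,z)·K^l(z,y) converges absolutely and equals 0 (i.e. K^r K^l = 0 as a composition of kernels). -/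

import Mathlib

/-- `R_{ρ,t}(x,y) = e^{−t}(1−ρ)^{x−y} t^{x−y}/(x−y)!` for `x ≥ y`, `0` otherwise. -/
noncomputable def Rker (ρ t : ℝ) (x y : ℤ) : ℝ :=
  if y ≤ x then
    Real.exp (-t) * (1 - ρ) ^ (x - y) * t ^ (x - y).toNat / (Nat.factorial (x - y).toNat)
  else 0

/-- `R_{ρ,t}^{-1}(x,y) = e^{t}(1−ρ)^{x−y}(−t)^{x−y}/(x−y)!` for `x ≥ y`, `0` otherwise. -/
noncomputable def Rinv (ρ t : ℝ) (x y : ℤ) : ℝ :=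
  if y ≤ x then
    Real.exp t * (1 - ρ) ^ (x - y) * (-t) ^ (x - y).toNat / (Nat.factorial (x - y).toNat)
  else 0

/-- `Q_ρ^{-1}(x,y) = (1/ρ)·1_{x=y−1} − ((1−ρ)/ρ)·1_{x=y}`. -/
noncomputable def Qinv (ρ : ℝ) (x y : ℤ) : ℝ :=
  (1 / ρ) * (if x = y - 1 then 1 else 0) - ((1 - ρ) / ρ) * (if x = y then 1 else 0)

/-- `Q_ρ^{-k}`, the `k`-fold convolution power of `Q_ρ^{-1}`, with `Q_ρ^{-0}` the identity. -/
noncomputable def Qinvpow (ρ : ℝ) : ℕ → ℤ → ℤ → ℝ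
  | 0 => fun x y => if x = y then 1 else 0
  | k + 1 => fun x y => ∑' z : ℤ, Qinv ρ x z * Qinvpow ρ k z y

/-- `h` solves the backwards-heat initial–boundary value problem for `(ρ, n, k, X₀)`. -/
def SolvesIBVP (ρ : ℝ) (n k : ℕ) (X₀ : ℕ → ℤ) (h : ℕ → ℤ → ℝ) : Prop :=
  (∀ l, l < k → ∀ z : ℤ, (1 / ρ) * h l (z - 1) - ((1 - ρ) / ρ) * h l z = h (l + 1) z) ∧
  (∀ z : ℤ, h k z = ρ * (1 - ρ) ^ (X₀ (n - k) - z - 1)) ∧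
  (∀ l, l < k → h l (X₀ (n - l)) = 0)

/-- `Ψ^n_{ρ,k}(x) := Σ_y R_{ρ,t}(x,y) Q_ρ^{-k}(y, X₀(n−k))`. -/
noncomputable def Psi (ρ t : ℝ) (n k : ℕ) (X₀ : ℕ → ℤ) (x : ℤ) : ℝ :=
  ∑' y : ℤ, Rker ρ t x y * Qinvpow ρ k y (X₀ (n - k))

/-- `Φ^n_{ρ,k}(z) := Σ_y ((1−ρ)/ρ) h_k(0,y) R_{ρ,t}^{-1}(y,z)`. -/
noncomputable def Phi (ρ t : ℝ) (hk0 : ℤ → ℝ) (z : ℤ) : ℝ :=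
  ∑' y : ℤ, ((1 - ρ) / ρ) * hk0 y * Rinv ρ t y z

theorem Rker_add_natCast (ρ t : ℝ) (w : ℤ) (i : ℕ) :
    Rker ρ t (w + i) w = Real.exp (-t) * ((1 - ρ) * t) ^ i / i.factorial := by
  simp [Rker, mul_pow, mul_assoc]

theorem Rker_of_lt {ρ t : ℝ} {x y : ℤ} (hxy : x < y) : Rker ρ t x y = 0 := by
  simp [Rker, not_le.mpr hxy]

theorem Rinv_add_natCast (ρ t : ℝ) (w : ℤ) (i : ℕ) :
    Rinv ρ t (w + i) w = Real.exp t * ((1 - ρ) * -t) ^ i / i.factorial := by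
  simp only [Rinv, le_add_iff_nonneg_right, Nat.cast_nonneg, if_true, add_sub_cancel_left,
    zpow_natCast, Int.toNat_natCast, mul_pow, mul_assoc]

theorem Rinv_of_lt {ρ t : ℝ} {x y : ℤ} (hxy : x < y) : Rinv ρ t x y = 0 := by
  simp [Rinv, not_le.mpr hxy]

/-- `R_{ρ,t}^{-1}` is a left inverse of `R_{ρ,t}`. -/
theorem tsum_Rinv_mul_Rker (ρ t : ℝ) (y w : ℤ) :
    ∑' z : ℤ, Rinv ρ t y z * Rker ρ t z w = if y = w then 1 else 0 := by
  rcases lt_or_ge y w with hyw | hyw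
  · rw [if_neg hyw.ne]
    convert tsum_zero with z
    rcases lt_or_ge y z with hz | hz
    · simp [Rinv_of_lt hz]
    · simp [Rker_of_lt (hz.trans_lt hyw)]
  obtain ⟨d, rfl⟩ := Int.le.dest hyw
  have hinj : Function.Injective (fun i : ℕ => w + (i : ℤ)) := fun i j hij => by simpa using hij
  rw [← hinj.tsum_eq, tsum_eq_sum (s := Finset.range (d + 1))]
  · have hterm : ∀ i ∈ Finset.range (d + 1),
        Rinv ρ t (w + d) (w + (i : ℤ)) * Rker ρ t (w + (i : ℤ)) w =
          (((1 - ρ) * t) ^ i * ((1 - ρ) * -t) ^ (d - i) * d.choose i) / d.factorial := by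
      intro i hi
      have hid : i ≤ d := Nat.lt_succ_iff.mp (Finset.mem_range.mp hi)
      have hsplit : w + (d : ℤ) = w + (i : ℤ) + ((d - i : ℕ) : ℤ) := by omega
      rw [hsplit, Rinv_add_natCast, Rker_add_natCast, Nat.cast_choose ℝ hid, Real.exp_neg]
      have := Real.exp_ne_zero t
      field_simp
    rw [Finset.sum_congr rfl hterm, ← Finset.sum_div, ← add_pow]
    have hzero : (1 - ρ) * t + (1 - ρ) * -t = 0 := by ring
    rw [hzero]
    rcases Nat.eq_zero_or_pos d with rfl | hd
    · simp
    · simp [hd.ne']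
  · intro i hi
    rw [Finset.mem_range] at hi
    rw [Rinv_of_lt (by omega), zero_mul]
  · intro z hz
    rw [Set.mem_range]
    refine ⟨(z - w).toNat, ?_⟩
    by_contra hne
    exact hz (by simp only; rw [Rker_of_lt (by omega), mul_zero])

theorem summable_mul_Rinv_mul_Rker (ρ t : ℝ) {f : ℤ → ℝ} (w : ℤ) {C B : ℝ}
    (hf : ∀ d : ℕ, |f (w + d)| ≤ C * B ^ d) :
    Summable fun p : ℤ × ℤ => f p.2 * Rinv ρ t p.2 p.1 * Rker ρ t p.1 w := by
  have hinj : Function.Injective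
      (fun p : ℕ × ℕ => ((w + (p.1 : ℤ), w + (p.1 : ℤ) + (p.2 : ℤ)) : ℤ × ℤ)) := by
    rintro ⟨i, j⟩ ⟨i', j'⟩ hij
    simp only [Prod.mk.injEq] at hij ⊢
    omega
  rw [← hinj.summable_iff]
  · have hexp := (Real.summable_pow_div_factorial (B * |(1 - ρ) * t|)).norm
    refine Summable.of_norm_bounded
      ((hexp.mul_of_nonneg hexp (fun _ => norm_nonneg _) (fun _ => norm_nonneg _)).mul_left |C|) ?_
    rintro ⟨i, j⟩
    have hb := (hf (i + j)).trans (le_abs_self _)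
    rw [abs_mul, abs_pow, pow_add] at hb
    push_cast at hb
    rw [← add_assoc] at hb
    have hrew : ‖f (w + i + j) * Rinv ρ t (w + i + j) (w + i) * Rker ρ t (w + i) w‖ =
        |f (w + i + j)| *
          (|(1 - ρ) * t| ^ j / j.factorial * (|(1 - ρ) * t| ^ i / i.factorial)) := by
      rw [Rinv_add_natCast, Rker_add_natCast, Real.exp_neg]
      simp only [Real.norm_eq_abs, abs_mul, abs_div, abs_pow, abs_neg, abs_inv, Real.abs_exp,
        Nat.abs_cast]
      have := Real.exp_ne_zero t
      field_simp
    simp only [Function.comp_apply]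
    rw [hrew]
    refine (mul_le_mul_of_nonneg_right hb (by positivity)).trans (le_of_eq ?_)
    simp only [norm_div, norm_pow, norm_mul, Real.norm_eq_abs, abs_abs, Nat.abs_cast, mul_pow,
      abs_mul]
    ring
  · rintro ⟨z, y⟩ hzy
    by_contra hne
    have hzw : w ≤ z := by
      by_contra hlt
      exact hne (by simp [Rker_of_lt (not_le.mp hlt)])
    have hyz : z ≤ y := by
      by_contra hlt
      exact hne (by simp [Rinv_of_lt (not_le.mp hlt)])
    refine hzy ⟨((z - w).toNat, (y - z).toNat), ?_⟩
    simp only [Prod.mk.injEq]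
    omega

/-- Composing `Φ` with `R_{ρ,t}` recovers the initial data, if it grows at most exponentially. -/
theorem hasSum_Phi_mul_Rker (ρ t : ℝ) {f : ℤ → ℝ} (w : ℤ) {C B : ℝ}
    (hf : ∀ d : ℕ, |f (w + d)| ≤ C * B ^ d) :
    HasSum (fun z : ℤ => Phi ρ t f z * Rker ρ t z w) ((1 - ρ) / ρ * f w) := by
  have hs := (summable_mul_Rinv_mul_Rker ρ t w hf).mul_left ((1 - ρ) / ρ)
  have hfun : ∀ z, Phi ρ t f z * Rker ρ t z w =
      ∑' y, (1 - ρ) / ρ * (f y * Rinv ρ t y z * Rker ρ t z w) := by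
    intro z
    rw [Phi, ← tsum_mul_right]
    exact tsum_congr fun y => by ring
  simp_rw [hfun]
  have hval : ∑' z, ∑' y, (1 - ρ) / ρ * (f y * Rinv ρ t y z * Rker ρ t z w) =
      (1 - ρ) / ρ * f w := by
    rw [← Summable.tsum_comm (f := fun z y => (1 - ρ) / ρ * (f y * Rinv ρ t y z * Rker ρ t z w)) hs]
    have hinner : ∀ y, ∑' z, (1 - ρ) / ρ * (f y * Rinv ρ t y z * Rker ρ t z w) =
        if y = w then (1 - ρ) / ρ * f w else 0 := by
      intro y
      simp_rw [mul_assoc (f y), tsum_mul_left, tsum_Rinv_mul_Rker]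
      split_ifs with hyw
      · simp [hyw]
      · simp
    simp_rw [hinner]
    exact tsum_ite_eq w _
  rw [← hval]
  exact hs.prod.hasSum

theorem Qinvpow_succ (ρ : ℝ) (k : ℕ) (x y : ℤ) :
    Qinvpow ρ (k + 1) x y =
      (1 / ρ) * Qinvpow ρ k (x + 1) y - ((1 - ρ) / ρ) * Qinvpow ρ k x y := by
  simp only [Qinvpow]
  rw [tsum_eq_sum (s := {x, x + 1})]
  · rw [Finset.sum_pair (by omega)]
    have hx : x ≠ x - 1 := by omega
    simp [Qinv, hx]
    ring
  · intro z hz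
    simp only [Finset.mem_insert, Finset.mem_singleton, not_or] at hz
    have h1 : x ≠ z - 1 := by omega
    simp [Qinv, h1, Ne.symm hz.1]

theorem Qinvpow_eq_zero (ρ : ℝ) (k : ℕ) {x y : ℤ} (hxy : x ∉ Finset.Icc (y - k) y) :
    Qinvpow ρ k x y = 0 := by
  induction k generalizing x with
  | zero =>
    have : x ≠ y := fun hxy' => hxy (by simp [hxy'])
    simp [Qinvpow, this]
  | succ k ih =>
    simp only [Finset.mem_Icc, Nat.cast_add, Nat.cast_one] at hxy ih
    rw [Qinvpow_succ, ih (by omega), ih (by omega)]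
    simp

theorem summable_mul_Qinvpow (ρ : ℝ) (k : ℕ) (f : ℤ → ℝ) (y : ℤ) :
    Summable fun x : ℤ => f x * Qinvpow ρ k x y :=
  summable_of_ne_finset_zero (s := Finset.Icc (y - k) y) fun x hx => by
    rw [Qinvpow_eq_zero ρ k hx, mul_zero]

theorem tsum_mul_Qinvpow {ρ : ℝ} {k : ℕ} {h : ℕ → ℤ → ℝ}
    (hrec : ∀ l, l < k → ∀ z : ℤ,
      (1 / ρ) * h l (z - 1) - ((1 - ρ) / ρ) * h l z = h (l + 1) z)
    (y : ℤ) (j l : ℕ) (hjl : l + j ≤ k) :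
    ∑' x : ℤ, h l x * Qinvpow ρ j x y = h (l + j) y := by
  induction j generalizing l with
  | zero => simp [Qinvpow]
  | succ j ih =>
    rw [show l + (j + 1) = l + 1 + j by ring, ← ih (l + 1) (by omega)]
    simp_rw [← hrec l (by omega), Qinvpow_succ, mul_sub, sub_mul]
    have hs := summable_mul_Qinvpow ρ j (fun x => (1 / ρ) * h l (x - 1)) y
    have hs' := (Equiv.addRight (1 : ℤ)).summable_iff.mpr hs
    have hs₂ := summable_mul_Qinvpow ρ j (fun x => ((1 - ρ) / ρ) * h l x) y
    have ht := (Equiv.addRight (1 : ℤ)).tsum_eq fun x => (1 / ρ) * h l (x - 1) * Qinvpow ρ j x y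
    rw [hs.tsum_sub hs₂, ← ht]
    refine Eq.trans ?_ (hs'.tsum_sub hs₂)
    refine tsum_congr fun x => ?_
    simp only [Function.comp_apply, Equiv.coe_addRight, add_sub_cancel_right]
    ring

theorem Psi_eq_sum (ρ t : ℝ) (n k : ℕ) (X₀ : ℕ → ℤ) (x : ℤ) :
    Psi ρ t n k X₀ x = ∑ y ∈ Finset.Icc (X₀ (n - k) - k) (X₀ (n - k)),
      Rker ρ t x y * Qinvpow ρ k y (X₀ (n - k)) :=
  tsum_eq_sum fun y hy => by rw [Qinvpow_eq_zero ρ k hy, mul_zero]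

/-- Solutions of the backwards-heat problem grow at most exponentially to the right. -/
theorem SolvesIBVP.exists_abs_le {ρ : ℝ} (hρ : ρ ∈ Set.Ioo (0 : ℝ) 1) {n k : ℕ} {X₀ : ℕ → ℤ}
    {h : ℕ → ℤ → ℝ} (hh : SolvesIBVP ρ n k X₀ h) (w : ℤ) (l : ℕ) (hl : l ≤ k) :
    ∃ C, ∀ d : ℕ, |h l (w + d)| ≤ C * (2 / (1 - ρ)) ^ d := by
  obtain ⟨hρ0, hρ1⟩ := hρ
  have ha : 0 < 1 - ρ := sub_pos.mpr hρ1
  induction hl using Nat.decreasingInduction with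
  | self =>
    refine ⟨ρ * (1 - ρ) ^ (X₀ (n - k) - w - 1), fun d => ?_⟩
    rw [hh.2.1, abs_of_pos (by positivity), mul_assoc]
    refine mul_le_mul_of_nonneg_left ?_ hρ0.le
    rw [show X₀ (n - k) - (w + d) - 1 = X₀ (n - k) - w - 1 - d by ring, zpow_sub₀ ha.ne',
      zpow_natCast, div_eq_mul_inv, ← inv_pow]
    refine mul_le_mul_of_nonneg_left ?_ (by positivity)
    rw [inv_eq_one_div]
    gcongr
    norm_num
  | of_succ l hl ih =>
    obtain ⟨C, hC⟩ := ih
    have hC0 : 0 ≤ C := by simpa using (abs_nonneg _).trans (hC 0)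
    refine ⟨max |h l w| (C * (2 / (1 - ρ))), fun d => ?_⟩
    induction d with
    | zero => simp
    | succ d ihd =>
      set M := max |h l w| (C * (2 / (1 - ρ)))
      have hM : C * (2 / (1 - ρ)) ≤ M := le_max_right _ _
      have hrec := hh.1 l hl (w + (d + 1 : ℕ))
      have hstep : h l (w + (d + 1 : ℕ)) =
          (h l (w + d) - ρ * h (l + 1) (w + (d + 1 : ℕ))) / (1 - ρ) := by
        rw [show w + ((d + 1 : ℕ) : ℤ) - 1 = w + d by push_cast; ring] at hrec
        rw [← hrec]
        field_simp
        ring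
      rw [hstep, abs_div, abs_of_pos ha, div_le_iff₀ ha]
      have h₁ : |ρ * h (l + 1) (w + (d + 1 : ℕ))| ≤ C * (2 / (1 - ρ)) ^ (d + 1) := by
        rw [abs_mul, abs_of_pos hρ0]
        exact (mul_le_of_le_one_left (abs_nonneg _) hρ1.le).trans (hC (d + 1))
      have h₂ : C * (2 / (1 - ρ)) ^ (d + 1) ≤ M * (2 / (1 - ρ)) ^ d := by
        rw [pow_succ', ← mul_assoc]
        exact mul_le_mul_of_nonneg_right hM (by positivity)
      have h₃ : M * (2 / (1 - ρ)) ^ (d + 1) * (1 - ρ) = 2 * (M * (2 / (1 - ρ)) ^ d) := by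
        rw [pow_succ]
        field_simp
      rw [h₃]
      linarith [abs_sub (h l (w + d)) (ρ * h (l + 1) (w + (d + 1 : ℕ)))]

/-- `Φ^n_{ρ,k}` and `Ψ^n_{ρ,j}` are orthogonal for `j < k`. -/
theorem hasSum_Phi_mul_Psi_of_lt {ρ : ℝ} (hρ : ρ ∈ Set.Ioo (0 : ℝ) 1) (t : ℝ) {n j k : ℕ}
    {X₀ : ℕ → ℤ} {h : ℕ → ℤ → ℝ} (hh : SolvesIBVP ρ n k X₀ h) (hjk : j < k) :
    HasSum (fun z : ℤ => Phi ρ t (h 0) z * Psi ρ t n j X₀ z) 0 := by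
  set X := X₀ (n - j)
  have hw : ∀ w ∈ Finset.Icc (X - j) X, HasSum
      (fun z : ℤ => Phi ρ t (h 0) z * Rker ρ t z w * Qinvpow ρ j w X)
      ((1 - ρ) / ρ * h 0 w * Qinvpow ρ j w X) := by
    intro w _
    obtain ⟨C, hC⟩ := hh.exists_abs_le hρ w 0 (Nat.zero_le k)
    exact (hasSum_Phi_mul_Rker ρ t w hC).mul_right _
  have hsum : ∑ w ∈ Finset.Icc (X - j) X, (1 - ρ) / ρ * h 0 w * Qinvpow ρ j w X = 0 := by
    have hpair := tsum_mul_Qinvpow hh.1 X j 0 (by omega)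
    rw [zero_add, hh.2.2 j hjk, tsum_eq_sum (s := Finset.Icc (X - j) X) fun w hw => by
      rw [Qinvpow_eq_zero ρ j hw, mul_zero]] at hpair
    simp_rw [mul_assoc, ← Finset.mul_sum, hpair, mul_zero]
  rw [← hsum]
  convert hasSum_sum hw using 2 with z
  simp_rw [Psi_eq_sum, Finset.mul_sum, mul_assoc]
  rfl


theorem stmt18 (ρ : ℝ) (hρ : ρ ∈ Set.Ioo (0 : ℝ) 1) (t : ℝ) (ht : 0 < t)
    (n : ℕ) (hn : 1 ≤ n)
    (X₀ : ℕ → ℤ) (hX : ∀ i j : ℕ, 1 ≤ i → i < j → j ≤ n → X₀ j < X₀ i)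
    (h : ℕ → ℕ → ℤ → ℝ) (hh : ∀ k, k ≤ n - 1 → SolvesIBVP ρ n k X₀ (h k))
    (m : ℕ) (hm : m ≤ n) (x y : ℤ) :
    Summable (fun z : ℤ =>
      |(∑ k ∈ Finset.Ico m n, Psi ρ t n k X₀ x * Phi ρ t (h k 0) z) *
        (∑ k ∈ Finset.range m, Psi ρ t n k X₀ z * Phi ρ t (h k 0) y)|) ∧
    (∑' z : ℤ,
        (∑ k ∈ Finset.Ico m n, Psi ρ t n k X₀ x * Phi ρ t (h k 0) z) *
          (∑ k ∈ Finset.range m, Psi ρ t n k X₀ z * Phi ρ t (h k 0) y)) = 0 := by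
  have hsum : HasSum (fun z : ℤ =>
      (∑ k ∈ Finset.Ico m n, Psi ρ t n k X₀ x * Phi ρ t (h k 0) z) *
        (∑ k ∈ Finset.range m, Psi ρ t n k X₀ z * Phi ρ t (h k 0) y)) 0 := by
    have hterm : ∀ k ∈ Finset.Ico m n, ∀ j ∈ Finset.range m, HasSum (fun z : ℤ =>
        Psi ρ t n k X₀ x * Phi ρ t (h k 0) z * (Psi ρ t n j X₀ z * Phi ρ t (h j 0) y)) 0 := by
      intro k hk j hj
      rw [Finset.mem_Ico] at hk
      rw [Finset.mem_range] at hj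
      have := ((hasSum_Phi_mul_Psi_of_lt hρ t (hh k (by omega)) (hj.trans_le hk.1)).mul_left
        (Psi ρ t n k X₀ x)).mul_right (Phi ρ t (h j 0) y)
      simpa [mul_assoc] using this
    simpa [Finset.sum_mul_sum] using hasSum_sum fun k hk => hasSum_sum (hterm k hk)
  exact ⟨hsum.summable.abs, hsum.tsum_eq⟩
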